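/- arXiv:1911.10733 — 2 statements merged into one kernel-verified Lean document; each statement's English description precedes it below -/
import Mathlib

section
/- Let A₁, …, Aₙ be positive invertible operators on H with mI ≤ Aⱼ ≤ MI (j = 1, …, n) for some scalars 0 < m < M, let Φ : B(H) → B(K) be a unital positive linear map, and let F (on H) and G (on K) each satisfy the arithmetic–harmonic sandwich for the probability vector ω. Then G(Φ(A₁), …, Φ(Aₙ)) ≤ ((M + m)²/(4Mm))·Φ(F(A₁, …, Aₙ)). -/
noncomputable section

/-- The arithmetic–harmonic sandwich for the probability vector `ω`:
`(∑ ωⱼ Bⱼ⁻¹)⁻¹ ≤ F (B₁, …, Bₙ) ≤ ∑ ωⱼ Bⱼ` for all positive invertible `B₁, …, Bₙ`,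
and `F` takes values in the positive invertible operators. -/
def IsAHSandwich {E : Type*} [NormedAddCommGroup E] [InnerProductSpace ℂ E]
    [CompleteSpace E] {n : ℕ} (ω : Fin n → ℝ)
    (F : (Fin n → (E →L[ℂ] E)) → (E →L[ℂ] E)) : Prop :=
  ∀ B : Fin n → (E →L[ℂ] E), (∀ j, 0 ≤ B j) → (∀ j, IsUnit (B j)) →
    (0 ≤ F B ∧ IsUnit (F B)) ∧
    Ring.inverse (∑ j, ω j • Ring.inverse (B j)) ≤ F B ∧
    F B ≤ ∑ j, ω j • B j

section CStarAlgebra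

variable {R : Type*} [CStarAlgebra R] [PartialOrder R] [StarOrderedRing R]

theorem isUnit_of_smul_one_le {m : ℝ} (hm : 0 < m) {a : R} (h : m • (1 : R) ≤ a) :
    IsUnit a := by
  have hu : IsUnit (m • (1 : R)) := by
    rw [← Algebra.algebraMap_eq_smul_one]
    exact (isUnit_iff_ne_zero.mpr hm.ne').map (algebraMap ℝ R)
  exact CStarAlgebra.isUnit_of_le _ h ⟨smul_nonneg hm.le zero_le_one, hu⟩

theorem one_le_smul_ringInverse {M : ℝ} {a : R} (ha0 : 0 ≤ a) (hau : IsUnit a)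
    (h : a ≤ M • (1 : R)) : 1 ≤ M • Ring.inverse a := by
  have hinv : 0 ≤ Ring.inverse a := (CFC.ringInverse_nonneg_iff_nonneg_of_isUnit hau).2 ha0
  have hc : Commute (M • (1 : R) - a) (Ring.inverse a) := by
    simp [commute_iff_eq, sub_mul, mul_sub, Ring.mul_inverse_cancel _ hau,
      Ring.inverse_mul_cancel _ hau]
  have := hc.mul_nonneg (sub_nonneg.2 h) hinv
  rwa [sub_mul, smul_one_mul, Ring.mul_inverse_cancel _ hau, sub_nonneg] at this

theorem add_smul_ringInverse_le {m M : ℝ} {a : R} (ha0 : 0 ≤ a) (hau : IsUnit a)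
    (h1 : m • (1 : R) ≤ a) (h2 : a ≤ M • (1 : R)) :
    a + (M * m) • Ring.inverse a ≤ (M + m) • (1 : R) := by
  have hc : Commute (a - m • (1 : R)) (M • Ring.inverse a - 1) := by
    simp only [commute_iff_eq, sub_mul, mul_sub, smul_mul_assoc, mul_smul_comm, one_mul, mul_one,
      Ring.mul_inverse_cancel _ hau, Ring.inverse_mul_cancel _ hau]
    module
  have h := hc.mul_nonneg (sub_nonneg.2 h1) (sub_nonneg.2 (one_le_smul_ringInverse ha0 hau h2))
  rw [← sub_nonneg]
  convert h using 1
  simp only [sub_mul, mul_sub, smul_mul_assoc, mul_smul_comm, one_mul, mul_one,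
    Ring.mul_inverse_cancel _ hau]
  module

theorem smul_one_le_ringInverse_add_smul {p : ℝ} (hp : 0 < p) (s : ℝ) {a : R} (ha0 : 0 ≤ a)
    (hau : IsUnit a) :
    s • (1 : R) ≤ (s ^ 2 / (4 * p)) • Ring.inverse a + p • a := by
  have hinv : 0 ≤ Ring.inverse a := (CFC.ringInverse_nonneg_iff_nonneg_of_isUnit hau).2 ha0
  have hsa : IsSelfAdjoint (p • a - (s / 2) • (1 : R)) :=
    ((IsSelfAdjoint.all p).smul (.of_nonneg ha0)).sub ((IsSelfAdjoint.all _).smul (.one R))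
  have h := smul_nonneg (inv_nonneg.2 hp.le) (hsa.conjugate_nonneg hinv)
  rw [← sub_nonneg]
  convert h using 1
  simp only [sub_mul, mul_sub, smul_mul_assoc, mul_smul_comm, one_mul, mul_one,
    Ring.mul_inverse_cancel _ hau, Ring.inverse_mul_cancel _ hau]
  match_scalars <;> field_simp <;> ring

/-- The Kantorovich inequality between the weighted arithmetic and harmonic means. -/
theorem sum_smul_le_smul_ringInverse_sum {ι : Type*} [Fintype ι] (w : ι → ℝ) (hw0 : ∀ j, 0 ≤ w j)
    (hw1 : ∑ j, w j = 1) {m M : ℝ} (hm : 0 < m) (hM : 0 < M) (a : ι → R)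
    (ha1 : ∀ j, m • (1 : R) ≤ a j) (ha2 : ∀ j, a j ≤ M • (1 : R)) :
    ∑ j, w j • a j ≤
      ((M + m) ^ 2 / (4 * M * m)) • Ring.inverse (∑ j, w j • Ring.inverse (a j)) := by
  have ha0 (j) : 0 ≤ a j := (smul_nonneg hm.le zero_le_one).trans (ha1 j)
  have hau (j) : IsUnit (a j) := isUnit_of_smul_one_le hm (ha1 j)
  have hsum (c : ℝ) : ∑ j, w j • (c • (1 : R)) = c • 1 := by
    rw [← Finset.sum_smul, hw1, one_smul]
  have hle : M⁻¹ • (1 : R) ≤ ∑ j, w j • Ring.inverse (a j) := by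
    rw [← hsum]
    refine Finset.sum_le_sum fun j _ => smul_le_smul_of_nonneg_left ?_ (hw0 j)
    have := smul_le_smul_of_nonneg_left (one_le_smul_ringInverse (ha0 j) (hau j) (ha2 j))
      (inv_nonneg.2 hM.le)
    rwa [inv_smul_smul₀ hM.ne'] at this
  have hupper : ∑ j, w j • a j + (M * m) • ∑ j, w j • Ring.inverse (a j) ≤
      (M + m) • (1 : R) := by
    rw [← hsum, Finset.smul_sum, ← Finset.sum_add_distrib]
    refine Finset.sum_le_sum fun j _ => ?_
    rw [smul_comm, ← smul_add]
    exact smul_le_smul_of_nonneg_left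
      (add_smul_ringInverse_le (ha0 j) (hau j) (ha1 j) (ha2 j)) (hw0 j)
  have hlower := smul_one_le_ringInverse_add_smul (mul_pos hM hm) (M + m)
    ((smul_nonneg (inv_nonneg.2 hM.le) zero_le_one).trans hle)
    (isUnit_of_smul_one_le (inv_pos.2 hM) hle)
  rw [mul_assoc]
  exact le_of_add_le_add_right (hupper.trans hlower)

end CStarAlgebra

theorem stmt3
    {H K : Type*}
    [NormedAddCommGroup H] [InnerProductSpace ℂ H] [CompleteSpace H]
    [NormedAddCommGroup K] [InnerProductSpace ℂ K] [CompleteSpace K]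
    {n : ℕ} (ω : Fin n → ℝ) (hω0 : ∀ j, 0 ≤ ω j) (hω1 : ∑ j, ω j = 1)
    (m M : ℝ) (hm : 0 < m) (hmM : m < M)
    (A : Fin n → (H →L[ℂ] H))
    (hA0 : ∀ j, 0 ≤ A j) (hAu : ∀ j, IsUnit (A j))
    (hA1 : ∀ j, m • (1 : H →L[ℂ] H) ≤ A j)
    (hA2 : ∀ j, A j ≤ M • (1 : H →L[ℂ] H))
    (Φ : (H →L[ℂ] H) →ₗ[ℂ] (K →L[ℂ] K))
    (hΦ1 : Φ 1 = 1) (hΦpos : ∀ T : H →L[ℂ] H, 0 ≤ T → 0 ≤ Φ T)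
    (F : (Fin n → (H →L[ℂ] H)) → (H →L[ℂ] H))
    (G : (Fin n → (K →L[ℂ] K)) → (K →L[ℂ] K))
    (hF : IsAHSandwich ω F) (hG : IsAHSandwich ω G)
    :
    G (fun j => Φ (A j)) ≤ ((M + m) ^ 2 / (4 * M * m)) • Φ (F A) := by
  have hmono {S T : H →L[ℂ] H} (h : S ≤ T) : Φ S ≤ Φ T := by
    have := hΦpos _ (sub_nonneg.2 h)
    rwa [map_sub, sub_nonneg] at this
  have hsmul (c : ℝ) (T : H →L[ℂ] H) : Φ (c • T) = c • Φ T := LinearMap.map_smul_of_tower Φ c T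
  have hlow (j) : m • (1 : K →L[ℂ] K) ≤ Φ (A j) := by
    simpa only [hsmul, hΦ1] using hmono (hA1 j)
  have hM : 0 < M := hm.trans hmM
  calc G (fun j => Φ (A j)) ≤ ∑ j, ω j • Φ (A j) :=
        (hG _ (fun j => hΦpos _ (hA0 j)) fun j => isUnit_of_smul_one_le hm (hlow j)).2.2
    _ = Φ (∑ j, ω j • A j) := by simp only [map_sum, hsmul]
    _ ≤ Φ (((M + m) ^ 2 / (4 * M * m)) • F A) := by
        refine hmono ((sum_smul_le_smul_ringInverse_sum ω hω0 hω1 hm hM A hA1 hA2).trans ?_)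
        exact smul_le_smul_of_nonneg_left (hF A hA0 hAu).2.1 (by positivity)
    _ = ((M + m) ^ 2 / (4 * M * m)) • Φ (F A) := hsmul _ _
end
end

section
/- Let A₁, …, Aₙ be positive invertible operators on H with mI ≤ Aⱼ ≤ MI (j = 1, …, n) for some scalars 0 < m < M, let Φ : B(H) → B(K) be a unital positive linear map, and let F (on H) and G (on K) each satisfy the arithmetic–harmonic sandwich for the probability vector ω. Then for every r ∈ (0, 1), G(Φ(A₁ʳ), …, Φ(Aₙʳ)) − Φ(F(A₁, …, Aₙ)ʳ) ≤ γ(1/M, 1/m, −r)·I, where γ(m, M, r) = γ(m, M, r, 1). -/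
noncomputable section

/-- The constant `γ(m, M, r, α)`, where real powers are `Real.rpow`. -/
def gammaConst (m M r α : ℝ) : ℝ :=
  if m ≤ ((M ^ r - m ^ r) / (α * r * (M - m))) ^ (1 / (r - 1)) ∧
      ((M ^ r - m ^ r) / (α * r * (M - m))) ^ (1 / (r - 1)) ≤ M then
    α * (r - 1) * ((M ^ r - m ^ r) / (α * r * (M - m))) ^ (r / (r - 1)) +
      (M * m ^ r - m * M ^ r) / (M - m)
  else if M ≤ ((M ^ r - m ^ r) / (α * r * (M - m))) ^ (1 / (r - 1)) then
    (1 - α) * M ^ r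
  else (1 - α) * m ^ r

/-- The tangent line inequality for the convex function `x ↦ x ^ s` with `s ≤ 0`. -/
theorem Real.rpow_tangent_le {s t u : ℝ} (hs : s ≤ 0) (ht : 0 < t) (hu : 0 < u) :
    u ^ s + s * u ^ (s - 1) * (t - u) ≤ t ^ s := by
  have htu : 0 < t / u := div_pos ht hu
  have hexp : s * (t / u - 1) + 1 ≤ (t / u) ^ s :=
    calc s * (t / u - 1) + 1 ≤ Real.log (t / u) * s + 1 := by
          nlinarith [mul_le_mul_of_nonpos_left (Real.log_le_sub_one_of_pos htu) hs]
      _ ≤ Real.exp (Real.log (t / u) * s) := Real.add_one_le_exp _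
      _ = (t / u) ^ s := (Real.rpow_def_of_pos htu s).symm
  have hpos : 0 < u ^ s := Real.rpow_pos_of_pos hu s
  rw [Real.div_rpow ht.le hu.le, le_div_iff₀ hpos] at hexp
  rw [Real.rpow_sub_one hu.ne']
  calc _ = (s * (t / u - 1) + 1) * u ^ s := by field_simp; ring
    _ ≤ t ^ s := hexp

theorem Real.rpow_le_chord {s m M t : ℝ} (hs : s ≤ 0) (hm : 0 < m) (hmM : m < M)
    (hmt : m ≤ t) (htM : t ≤ M) :
    t ^ s ≤ (M ^ s - m ^ s) / (M - m) * t + (M * m ^ s - m * M ^ s) / (M - m) := by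
  have ht : 0 < t := hm.trans_le hmt
  have h₁ := mul_le_mul_of_nonneg_left (Real.rpow_tangent_le hs hm ht) (sub_nonneg.2 htM)
  have h₂ := mul_le_mul_of_nonneg_left (Real.rpow_tangent_le hs (hm.trans hmM) ht)
    (sub_nonneg.2 hmt)
  rw [div_mul_eq_mul_div, ← add_div, le_div_iff₀ (sub_pos.2 hmM)]
  linarith

/-- For `α = 1` the constant `γ` is given by the point where the tangent to `x ↦ x ^ s` is parallel
to the chord over `[m, M]`. -/
theorem exists_gammaConst_one_eq {s m M : ℝ} (hs : s < 0) (hm : 0 < m) (hmM : m < M) :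
    ∃ u : ℝ, 0 < u ∧ (M ^ s - m ^ s) / (M - m) = s * u ^ (s - 1) ∧
      gammaConst m M s 1 = (s - 1) * u ^ s + (M * m ^ s - m * M ^ s) / (M - m) := by
  have hM : 0 < M := hm.trans hmM
  have hs1 : s - 1 ≠ 0 := by linarith
  have hz : 1 / (s - 1) ≤ 0 := one_div_nonpos.2 (by linarith)
  set q := (M ^ s - m ^ s) / (1 * s * (M - m)) with hq
  have hden : 1 * s * (M - m) < 0 := by nlinarith
  have hqm : q ≤ m ^ (s - 1) := by
    rw [hq, div_le_iff_of_neg hden]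
    linarith [Real.rpow_tangent_le hs.le hM hm]
  have hMq : M ^ (s - 1) ≤ q := by
    rw [hq, le_div_iff_of_neg hden]
    linarith [Real.rpow_tangent_le hs.le hm hM]
  have hq0 : 0 < q := (Real.rpow_pos_of_pos hM _).trans_le hMq
  have hinv : ∀ x : ℝ, 0 < x → (x ^ (s - 1)) ^ (1 / (s - 1)) = x := fun x hx => by
    rw [← Real.rpow_mul hx.le, mul_one_div_cancel hs1, Real.rpow_one]
  have h₁ : m ≤ q ^ (1 / (s - 1)) := by
    have := Real.rpow_le_rpow_of_nonpos hq0 hqm hz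
    rwa [hinv m hm] at this
  have h₂ : q ^ (1 / (s - 1)) ≤ M := by
    have := Real.rpow_le_rpow_of_nonpos (Real.rpow_pos_of_pos hM _) hMq hz
    rwa [hinv M hM] at this
  refine ⟨q ^ (1 / (s - 1)), Real.rpow_pos_of_pos hq0 _, ?_, ?_⟩
  · rw [← Real.rpow_mul hq0.le, one_div_mul_cancel hs1, Real.rpow_one, hq]
    have := hs.ne
    field_simp
  · rw [gammaConst, ← hq, if_pos ⟨h₁, h₂⟩, ← Real.rpow_mul hq0.le, one_div_mul_eq_div, one_mul]

theorem chord_le_rpow_add_gammaConst {s m M t : ℝ} (hs : s < 0) (hm : 0 < m) (hmM : m < M)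
    (ht : 0 < t) :
    (M ^ s - m ^ s) / (M - m) * t + (M * m ^ s - m * M ^ s) / (M - m) ≤
      t ^ s + gammaConst m M s 1 := by
  obtain ⟨u, hu, hslope, hγ⟩ := exists_gammaConst_one_eq hs hm hmM
  have htan := Real.rpow_tangent_le hs.le ht hu
  have hpow : u ^ (s - 1) * u = u ^ s := by
    rw [Real.rpow_sub_one hu.ne', div_mul_cancel₀ _ hu.ne']
  rw [hslope, hγ]
  linear_combination htan + s * hpow

open scoped Ring

theorem ringInverse_smul_one {A : Type*} [Ring A] [Algebra ℝ A] {c : ℝ} (hc : c ≠ 0) :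
    (c • (1 : A))⁻¹ʳ = c⁻¹ • (1 : A) := by
  have hu : IsUnit (c • (1 : A)) := isUnit_one.smul (Units.mk0 c hc)
  rw [← one_mul (c • (1 : A))⁻¹ʳ, eq_comm, Ring.eq_mul_inverse_iff_mul_eq _ _ _ hu]
  simp [smul_smul, hc]

theorem cfc_affine {A : Type*} [CStarAlgebra A] {T : A} (hT : IsSelfAdjoint T) (a b : ℝ) :
    cfc (fun x : ℝ => a * x + b) T = a • T + b • (1 : A) := by
  rw [cfc_add_const b (fun x : ℝ => a * x) T, cfc_const_mul_id a T, Algebra.algebraMap_eq_smul_one]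

section CStarAlgebra

variable {A : Type*} [CStarAlgebra A] [PartialOrder A] [StarOrderedRing A]

theorem IsStrictlyPositive.of_smul_one_le {T : A} {c : ℝ} (hc : 0 < c) (h : c • (1 : A) ≤ T) :
    IsStrictlyPositive T :=
  IsStrictlyPositive.of_le (IsStrictlyPositive.smul hc isStrictlyPositive_one) h

theorem spectrum_pos_of_isStrictlyPositive {T : A} (hT : IsStrictlyPositive T) :
    ∀ x ∈ spectrum ℝ T, 0 < x :=
  (CStarAlgebra.isStrictlyPositive_iff_isSelfAdjoint_and_spectrum_pos.1 hT).2

theorem rpow_neg_eq_cfc_ringInverse {T : A} (hT : IsStrictlyPositive T) {r : ℝ} :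
    T⁻¹ʳ ^ r = cfc (fun x : ℝ => x ^ (-r)) T := by
  rw [CFC.inverse_eq_rpow_neg_one hT, CFC.rpow_rpow T (-1) r (by norm_num) hT,
    neg_one_mul, CFC.rpow_eq_cfc_real hT.nonneg]

theorem continuousOn_rpow_spectrum {T : A} (hT : IsStrictlyPositive T) (s : ℝ) :
    ContinuousOn (fun x : ℝ => x ^ s) (spectrum ℝ T) :=
  continuousOn_id.rpow_const fun x hx => Or.inl (spectrum_pos_of_isStrictlyPositive hT x hx).ne'

theorem rpow_neg_le_affine {T : A} {r m M : ℝ} (hr : 0 ≤ r) (hm : 0 < m) (hmM : m < M)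
    (hmT : m • (1 : A) ≤ T) (hTM : T ≤ M • (1 : A)) :
    T⁻¹ʳ ^ r ≤ ((M ^ (-r) - m ^ (-r)) / (M - m)) • T +
      ((M * m ^ (-r) - m * M ^ (-r)) / (M - m)) • (1 : A) := by
  have hT := IsStrictlyPositive.of_smul_one_le hm hmT
  have hsa : IsSelfAdjoint T := hT.nonneg.isSelfAdjoint
  rw [← Algebra.algebraMap_eq_smul_one, algebraMap_le_iff_le_spectrum] at hmT
  rw [← Algebra.algebraMap_eq_smul_one, le_algebraMap_iff_spectrum_le] at hTM
  rw [rpow_neg_eq_cfc_ringInverse hT, ← cfc_affine hsa]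
  exact cfc_mono (fun x hx => Real.rpow_le_chord (by linarith) hm hmM (hmT x hx) (hTM x hx))
    (continuousOn_rpow_spectrum hT _)

theorem affine_le_rpow_neg_add_gammaConst {T : A} {r m M : ℝ} (hr : 0 < r) (hm : 0 < m)
    (hmM : m < M) (hT : IsStrictlyPositive T) :
    ((M ^ (-r) - m ^ (-r)) / (M - m)) • T +
      ((M * m ^ (-r) - m * M ^ (-r)) / (M - m)) • (1 : A) ≤
      T⁻¹ʳ ^ r + gammaConst m M (-r) 1 • (1 : A) := by
  have hsa : IsSelfAdjoint T := hT.nonneg.isSelfAdjoint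
  have hc := continuousOn_rpow_spectrum hT (-r)
  rw [rpow_neg_eq_cfc_ringInverse hT, ← cfc_affine hsa, ← Algebra.algebraMap_eq_smul_one,
    ← cfc_add_const _ _ T hc]
  exact cfc_mono (fun x hx => chord_le_rpow_add_gammaConst (by linarith) hm hmM
    (spectrum_pos_of_isStrictlyPositive hT x hx)) (by fun_prop) (hc.add continuousOn_const)

theorem smul_one_le_ringInverse {T : A} {M : ℝ} (hM : 0 < M) (hT : IsStrictlyPositive T)
    (h : T ≤ M • (1 : A)) : (1 / M) • (1 : A) ≤ T⁻¹ʳ := by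
  simpa [ringInverse_smul_one hM.ne'] using CStarAlgebra.ringInverse_le_ringInverse h hT

theorem ringInverse_le_smul_one {T : A} {m : ℝ} (hm : 0 < m)
    (h : m • (1 : A) ≤ T) : T⁻¹ʳ ≤ (1 / m) • (1 : A) := by
  simpa [ringInverse_smul_one hm.ne'] using
    CStarAlgebra.ringInverse_le_ringInverse h (IsStrictlyPositive.smul hm isStrictlyPositive_one)

theorem smul_one_le_rpow {T : A} {m r : ℝ} (hm : 0 < m) (hr : 0 ≤ r) (h : m • (1 : A) ≤ T) :
    m ^ r • (1 : A) ≤ T ^ r := by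
  have hT := IsStrictlyPositive.of_smul_one_le hm h
  have hsa : IsSelfAdjoint T := hT.nonneg.isSelfAdjoint
  rw [← Algebra.algebraMap_eq_smul_one, algebraMap_le_iff_le_spectrum] at h
  rw [← Algebra.algebraMap_eq_smul_one, CFC.rpow_eq_cfc_real hT.nonneg]
  exact algebraMap_le_cfc _ _ _ (fun x hx => Real.rpow_le_rpow hm.le (h x hx) hr)
    (continuousOn_rpow_spectrum hT r)

end CStarAlgebra

theorem stmt6
    {H K : Type*}
    [NormedAddCommGroup H] [InnerProductSpace ℂ H] [CompleteSpace H]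
    [NormedAddCommGroup K] [InnerProductSpace ℂ K] [CompleteSpace K]
    {n : ℕ} (ω : Fin n → ℝ) (hω0 : ∀ j, 0 ≤ ω j) (hω1 : ∑ j, ω j = 1)
    (m M : ℝ) (hm : 0 < m) (hmM : m < M)
    (A : Fin n → (H →L[ℂ] H))
    (hA0 : ∀ j, 0 ≤ A j) (hAu : ∀ j, IsUnit (A j))
    (hA1 : ∀ j, m • (1 : H →L[ℂ] H) ≤ A j)
    (hA2 : ∀ j, A j ≤ M • (1 : H →L[ℂ] H))
    (Φ : (H →L[ℂ] H) →ₗ[ℂ] (K →L[ℂ] K))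
    (hΦ1 : Φ 1 = 1) (hΦpos : ∀ T : H →L[ℂ] H, 0 ≤ T → 0 ≤ Φ T)
    (F : (Fin n → (H →L[ℂ] H)) → (H →L[ℂ] H))
    (G : (Fin n → (K →L[ℂ] K)) → (K →L[ℂ] K))
    (hF : IsAHSandwich ω F) (hG : IsAHSandwich ω G)
    (r : ℝ) (hr : r ∈ Set.Ioo (0 : ℝ) 1)
    :
    G (fun j => Φ (CFC.rpow (A j) r)) - Φ (CFC.rpow (F A) r) ≤
      gammaConst (1 / M) (1 / m) (-r) 1 • (1 : K →L[ℂ] K) := by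
  obtain ⟨hr0, hr1⟩ := hr
  have hM : 0 < M := hm.trans hmM
  have hmM' : 1 / M < 1 / m := one_div_lt_one_div_of_lt hm hmM
  have hΦmono : ∀ {S T : H →L[ℂ] H}, S ≤ T → Φ S ≤ Φ T := fun {S T} hST => by
    simpa using hΦpos (T - S) (sub_nonneg.2 hST)
  have hΦsmul : ∀ (c : ℝ) (T : H →L[ℂ] H), Φ (c • T) = c • Φ T := fun c T =>
    (Φ.restrictScalars ℝ).map_smul c T
  have hApos : ∀ j, IsStrictlyPositive (A j) := fun j => ⟨hA0 j, hAu j⟩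
  set B : Fin n → (H →L[ℂ] H) := fun j => (A j)⁻¹ʳ with hB
  have hB1 : ∀ j, (1 / M) • (1 : H →L[ℂ] H) ≤ B j := fun j =>
    smul_one_le_ringInverse hM (hApos j) (hA2 j)
  have hB2 : ∀ j, B j ≤ (1 / m) • (1 : H →L[ℂ] H) := fun j => ringInverse_le_smul_one hm (hA1 j)
  set C : H →L[ℂ] H := ∑ j, ω j • B j with hC
  have hCpos : IsStrictlyPositive C := by
    refine IsStrictlyPositive.of_smul_one_le (one_div_pos.2 hM) ?_
    calc (1 / M) • (1 : H →L[ℂ] H) = ∑ j, ω j • (1 / M) • (1 : H →L[ℂ] H) := by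
          rw [← Finset.sum_smul, hω1, one_smul]
      _ ≤ C := Finset.sum_le_sum fun j _ => smul_le_smul_of_nonneg_left (hB1 j) (hω0 j)
  have hΦA : ∀ j, IsStrictlyPositive (Φ (A j ^ r)) := fun j => by
    refine IsStrictlyPositive.of_smul_one_le (Real.rpow_pos_of_pos hm r) ?_
    simpa [hΦsmul, hΦ1] using hΦmono (smul_one_le_rpow hm hr0.le (hA1 j))
  have hGle : G (fun j => Φ (A j ^ r)) ≤ ∑ j, ω j • Φ (A j ^ r) :=
    (hG _ (fun j => (hΦA j).nonneg) fun j => (hΦA j).isUnit).2.2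
  have hFge : C⁻¹ʳ ^ r ≤ F A ^ r := CFC.rpow_le_rpow ⟨hr0.le, hr1.le⟩ (hF A hA0 hAu).2.1
  set a := ((1 / m) ^ (-r) - (1 / M) ^ (-r)) / (1 / m - 1 / M)
  set b := (1 / m * (1 / M) ^ (-r) - 1 / M * (1 / m) ^ (-r)) / (1 / m - 1 / M)
  have hArle : ∀ j, A j ^ r ≤ a • B j + b • (1 : H →L[ℂ] H) := fun j => by
    have h := rpow_neg_le_affine hr0.le (one_div_pos.2 hM) hmM' (hB1 j) (hB2 j)
    rwa [hB, Ring.inverse_inverse (hAu j)] at h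
  have hsum : ∑ j, ω j • A j ^ r ≤ F A ^ r + gammaConst (1 / M) (1 / m) (-r) 1 • 1 :=
    calc ∑ j, ω j • A j ^ r ≤ ∑ j, ω j • (a • B j + b • (1 : H →L[ℂ] H)) :=
          Finset.sum_le_sum fun j _ => smul_le_smul_of_nonneg_left (hArle j) (hω0 j)
      _ = a • C + b • (1 : H →L[ℂ] H) := by
          simp only [smul_add, Finset.sum_add_distrib, ← Finset.sum_smul, hω1, one_smul, hC,
            Finset.smul_sum, smul_comm a]
      _ ≤ C⁻¹ʳ ^ r + gammaConst (1 / M) (1 / m) (-r) 1 • 1 :=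
          affine_le_rpow_neg_add_gammaConst hr0 (one_div_pos.2 hM) hmM' hCpos
      _ ≤ _ := by gcongr
  have hfinal := hΦmono hsum
  simp only [map_sum, map_add, hΦsmul, hΦ1] at hfinal
  exact sub_le_iff_le_add'.2 (hGle.trans hfinal)
end
end
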